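/- arXiv:1306.6512 — 3 statements merged into one kernel-verified Lean document; each statement's English description precedes it below -/
import Mathlib

section
/- Let (X,d) be a metric space, 0 < T < ∞, γ : [0,T] → X a continuous rectifiable curve, and V = (V_j) a parallel variation of γ. Then for every s, t ∈ [0,T], lim_{j→∞} | d(V_j(t), γ(t)) − d(V_j(s), γ(s)) | / d(V_j(s), γ(s)) = 0. -/
open Filter Topology

variable {X : Type*} [MetricSpace X]

/-- `t` and `u` are consecutive points of the finite set (partition) `s`. -/
def Consecutive (s : Finset ℝ) (t u : ℝ) : Prop :=
  t ∈ s ∧ u ∈ s ∧ t < u ∧ ∀ r ∈ s, r ≤ t ∨ u ≤ r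

/-- The parallelogram defects `e_j` of a quadruple of points of a metric space,
indexed cyclically by `Fin 4`. -/
noncomputable def eQuad (x : Fin 4 → X) (j : Fin 4) : ℝ :=
  2 * dist (x (j + 1)) (x j) ^ 2 + 2 * dist (x j) (x (j - 1)) ^ 2
    - dist (x 2) (x 0) ^ 2 - dist (x 3) (x 1) ^ 2

/-- A quadruple `(x₁,x₂,x₃,x₄)` in a metric space is an `ε`-parallelogram. -/
noncomputable def IsEpsParallelogram (ε : ℝ) (x : Fin 4 → X) : Prop :=
  let Pv : ℝ := max (dist (x 0) (x 3)) (dist (x 1) (x 2))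
  let Px : ℝ := max (dist (x 0) (x 1)) (dist (x 2) (x 3))
  |eQuad x 0 + eQuad x 1| ≤ ε * Px * Pv ∧
  |eQuad x 2 + eQuad x 3| ≤ ε * Px * Pv ∧
  |eQuad x 1 - eQuad x 0| ≤ ε * Pv ^ 2 ∧
  |eQuad x 3 - eQuad x 2| ≤ ε * Pv ^ 2 ∧
  |eQuad x 0 + eQuad x 2| ≤ ε * Pv ^ 2

/-- A partition of `[a,b]`: a finite subset of `[a,b]`. -/
def IsPartition (s : Finset ℝ) (a b : ℝ) : Prop :=
  ∀ r ∈ s, r ∈ Set.Icc a b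

/-- A variation of the curve `γ` on `[a,b]`: a sequence of maps `V j` converging
pointwise to `γ` and equal to `γ` at each time for at most finitely many `j`. -/
def IsVariationOn (γ : ℝ → X) (V : ℕ → ℝ → X) (a b : ℝ) : Prop :=
  ∀ t ∈ Set.Icc a b,
    Filter.Tendsto (fun j => V j t) Filter.atTop (nhds (γ t)) ∧ {j : ℕ | V j t = γ t}.Finite

/-- A parallel variation of the curve `γ` on `[a,b]`: a variation such that for every
`ε > 0` there is a partition `s'` of `[a,b]` such that for every refinement `s ⊇ s'` and
all sufficiently large `j`, the quadruples `(γ(t_a), γ(t_{a+1}), V_j(t_{a+1}), V_j(t_a))`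
over consecutive points of `s` are `(ε·d(γ(t_a),γ(t_{a+1})))`-parallelograms. -/
def IsParallelVariationOn (γ : ℝ → X) (V : ℕ → ℝ → X) (a b : ℝ) : Prop :=
  IsVariationOn γ V a b ∧
  ∀ ε : ℝ, 0 < ε → ∃ s' : Finset ℝ, IsPartition s' a b ∧
    ∀ s : Finset ℝ, s' ⊆ s → IsPartition s a b →
      ∃ J : ℕ, ∀ j : ℕ, J ≤ j → ∀ t u : ℝ, Consecutive s t u →
        IsEpsParallelogram (ε * dist (γ t) (γ u)) ![γ t, γ u, V j u, V j t]

/-- An increment bound on consecutive points of a finite set propagates to all pairs of points. -/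
theorem abs_sub_le_of_consecutive {s : Finset ℝ} {F g : ℝ → ℝ}
    (h : ∀ t u, Consecutive s t u → |F u - F t| ≤ g u - g t) {p : ℝ} (hp : p ∈ s) :
    ∀ q ∈ s, p ≤ q → |F q - F p| ≤ g q - g p := by
  intro q
  induction hn : (s.filter (· < q)).card using Nat.strong_induction_on generalizing q with
  | _ n ih =>
    intro hq hpq
    rcases hpq.eq_or_lt with rfl | hlt
    · simp
    have hne : (s.filter (· < q)).Nonempty := ⟨p, by simp [hp, hlt]⟩
    obtain ⟨r, hr, hmax⟩ := (s.filter (· < q)).exists_max_image id hne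
    simp only [Finset.mem_filter, id] at hr hmax
    have hcons : Consecutive s r q := by
      refine ⟨hr.1, hq, hr.2, fun x hx => ?_⟩
      by_cases hxq : x < q
      · exact Or.inl (hmax x ⟨hx, hxq⟩)
      · exact Or.inr (not_lt.mp hxq)
    have hcard : (s.filter (· < r)).card < n := by
      rw [← hn]
      apply Finset.card_lt_card
      rw [Finset.ssubset_iff_of_subset]
      · exact ⟨r, by simp [hr], by simp⟩
      · intro x hx
        simp only [Finset.mem_filter] at hx ⊢
        exact ⟨hx.1, hx.2.trans hr.2⟩
    have h1 := ih _ hcard r rfl hr.1 (hmax p ⟨hp, hlt⟩)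
    have h2 := h r q hcons
    have h3 := abs_sub_le (F q) (F r) (F p)
    linarith

theorem log_sub_log_le_of_sq_sub_sq_le {a b c : ℝ} (ha : 0 < a) (hb : 0 < b) (hc : c ≤ 1)
    (h : 2 * (b ^ 2 - a ^ 2) ≤ c * b ^ 2) (hc0 : 0 ≤ c) : Real.log b - Real.log a ≤ c := by
  have hlog := Real.log_le_sub_one_of_pos (show 0 < b ^ 2 / a ^ 2 by positivity)
  rw [Real.log_div (by positivity) (by positivity), Real.log_pow, Real.log_pow] at hlog
  have hb2 : b ^ 2 ≤ 2 * a ^ 2 := by nlinarith [sq_nonneg b]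
  have hdiv : b ^ 2 / a ^ 2 ≤ 1 + c := by
    rw [div_le_iff₀ (by positivity)]
    nlinarith
  push_cast at hlog
  linarith

theorem abs_log_sub_log_le_of_abs_sq_sub_sq_le {a b c : ℝ} (ha : 0 < a) (hb : 0 < b)
    (hc0 : 0 ≤ c) (hc : c ≤ 1) (h : |2 * (b ^ 2 - a ^ 2)| ≤ c * max a b ^ 2) :
    |Real.log b - Real.log a| ≤ c := by
  have h' := abs_le.mp h
  rcases le_total a b with hab | hab
  · rw [max_eq_right hab] at h'
    rw [abs_of_nonneg (sub_nonneg.mpr (Real.log_le_log ha hab))]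
    exact log_sub_log_le_of_sq_sub_sq_le ha hb hc h'.2 hc0
  · rw [max_eq_left hab] at h'
    rw [abs_sub_comm, abs_of_nonneg (sub_nonneg.mpr (Real.log_le_log hb hab))]
    exact log_sub_log_le_of_sq_sub_sq_le hb ha hc (by linarith [h'.1]) hc0

/-- The vertical sides of an `ε`-parallelogram with `ε ≤ 1` have comparable lengths. -/
theorem IsEpsParallelogram.abs_log_dist_sub_le {ε : ℝ} {x y y' x' : X} (hε0 : 0 ≤ ε)
    (hε : ε ≤ 1) (h : IsEpsParallelogram ε ![x, y, y', x']) (hx : x' ≠ x) (hy : y' ≠ y) :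
    |Real.log (dist y' y) - Real.log (dist x' x)| ≤ ε := by
  apply abs_log_sub_log_le_of_abs_sq_sub_sq_le (dist_pos.mpr hx) (dist_pos.mpr hy) hε0 hε
  have h3 := h.2.2.1
  have h01 : (0 : Fin 4) - 1 = 3 := rfl
  have h12 : (1 : Fin 4) + 1 = 2 := rfl
  simp only [eQuad, h01, h12, zero_add, sub_self, Matrix.cons_val] at h3
  rw [dist_comm x x', dist_comm y y'] at h3
  convert h3 using 2
  ring

theorem IsVariationOn.eventually_ne {γ : ℝ → X} {V : ℕ → ℝ → X} {a b r : ℝ}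
    (hV : IsVariationOn γ V a b) (hr : r ∈ Set.Icc a b) : ∀ᶠ j in atTop, V j r ≠ γ r := by
  rw [← Nat.cofinite_eq_atTop]
  exact (hV r hr).2.eventually_cofinite_notMem

/-- The logarithms of the norms of a parallel variation differ by `o(1)`. -/
theorem IsParallelVariationOn.tendsto_log_sub_log {γ : ℝ → X} {V : ℕ → ℝ → X} {a b : ℝ}
    (hV : IsParallelVariationOn γ V a b) (hγ : BoundedVariationOn γ (Set.Icc a b))
    {p q : ℝ} (hp : p ∈ Set.Icc a b) (hq : q ∈ Set.Icc a b) :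
    Tendsto (fun j => Real.log (dist (V j q) (γ q)) - Real.log (dist (V j p) (γ p)))
      atTop (𝓝 0) := by
  wlog hpq : p ≤ q generalizing p q
  · simpa using (this hq hp (le_of_not_ge hpq)).neg
  rw [Metric.tendsto_atTop]
  intro η hη
  set S := Set.Icc a b
  have hloc := hγ.locallyBoundedVariationOn
  set L := (eVariationOn γ S).toReal
  have hL : 0 ≤ L := ENNReal.toReal_nonneg
  set ε := min 1 (η / 2) / (L + 1)
  have hε : 0 < ε := by positivity
  have hεL : ε * (L + 1) = min 1 (η / 2) := by
    simp only [ε]; field_simp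
  obtain ⟨s', hs', H⟩ := hV.2 ε hε
  have hpart : IsPartition (insert p (insert q s')) a b := by
    intro r hr
    simp only [Finset.mem_insert] at hr
    rcases hr with rfl | rfl | hr
    exacts [hp, hq, hs' r hr]
  set s := insert p (insert q s')
  obtain ⟨J, hJ⟩ := H s (fun r hr => by simp [s, hr]) hpart
  have hne : ∀ᶠ j in atTop, ∀ r ∈ s, V j r ≠ γ r := by
    rw [Filter.eventually_all_finset]
    intro r hr
    exact hV.1.eventually_ne (hpart r hr)
  obtain ⟨J', hJ'⟩ := eventually_atTop.mp hne
  refine ⟨max J J', fun j hj => ?_⟩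
  have hdist : ∀ t ∈ S, ∀ u ∈ S, dist (γ t) (γ u) ≤ L := fun t ht u hu =>
    hγ.dist_le ht hu
  have key := abs_sub_le_of_consecutive (s := s)
    (F := fun r => Real.log (dist (V j r) (γ r)))
    (g := fun r => ε * variationOnFromTo γ S p r) (p := p) ?_ (by simp [s]) q (by simp [s]) hpq
  · rw [Real.dist_eq, sub_zero]
    have hvar : variationOnFromTo γ S p q ≤ L := by
      rw [variationOnFromTo.eq_of_le γ S hpq]
      exact ENNReal.toReal_mono hγ (eVariationOn.mono _ Set.inter_subset_left)
    rw [variationOnFromTo.self, mul_zero, sub_zero] at key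
    have := mul_le_mul_of_nonneg_left hvar hε.le
    have := min_le_right 1 (η / 2)
    linarith
  · intro t u htu
    have ht := hpart t htu.1
    have hu := hpart u htu.2.1
    have hsmall : ε * dist (γ t) (γ u) ≤ 1 := by
      have := mul_le_mul_of_nonneg_left (hdist t ht u hu) hε.le
      have := min_le_left 1 (η / 2)
      linarith
    have hstep := (hJ j (le_of_max_le_left hj) t u htu).abs_log_dist_sub_le
      (by positivity) hsmall (hJ' j (le_of_max_le_right hj) t htu.1)
      (hJ' j (le_of_max_le_right hj) u htu.2.1)
    refine hstep.trans ?_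
    rw [← mul_sub]
    apply mul_le_mul_of_nonneg_left _ hε.le
    rw [← variationOnFromTo.add hloc hp ht hu, add_sub_cancel_left,
      variationOnFromTo.eq_of_le γ S htu.2.2.1.le, dist_edist]
    exact ENNReal.toReal_mono (hloc t u ht hu)
      (eVariationOn.edist_le γ ⟨ht, le_rfl, htu.2.2.1.le⟩ ⟨hu, htu.2.2.1.le, le_rfl⟩)

/-- Theorem (parallel norm property): for a parallel variation `V` of a continuous
rectifiable curve `γ : [0,T] → X`, one has
`|d(V_j(t),γ(t)) − d(V_j(s),γ(s))| / d(V_j(s),γ(s)) → 0` for all `s,t ∈ [0,T]`. -/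
theorem parallel_variation_norm {T : ℝ} (hT : 0 < T) (γ : ℝ → X)
    (hcont : ContinuousOn γ (Set.Icc 0 T))
    (hrect : BoundedVariationOn γ (Set.Icc 0 T))
    (V : ℕ → ℝ → X) (hV : IsParallelVariationOn γ V 0 T) :
    ∀ s ∈ Set.Icc (0 : ℝ) T, ∀ t ∈ Set.Icc (0 : ℝ) T,
      Filter.Tendsto
        (fun j => |dist (V j t) (γ t) - dist (V j s) (γ s)| / dist (V j s) (γ s))
        Filter.atTop (nhds (0 : ℝ)) := by
  intro s hs t ht
  have hlog := hV.tendsto_log_sub_log hrect hs ht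
  have hlim : Tendsto (fun j => |Real.exp (Real.log (dist (V j t) (γ t))
      - Real.log (dist (V j s) (γ s))) - 1|) atTop (𝓝 0) := by
    simpa using (((Real.continuous_exp.tendsto 0).comp hlog).sub_const 1).abs
  refine hlim.congr' ?_
  filter_upwards [hV.1.eventually_ne hs, hV.1.eventually_ne ht] with j hjs hjt
  have hs0 := dist_pos.mpr hjs
  rw [Real.exp_sub, Real.exp_log (dist_pos.mpr hjt), Real.exp_log hs0,
    div_sub_one hs0.ne', abs_div, abs_of_pos hs0]
end

section
/- Let κ ≥ 0 and T ≥ 0, let (Ω, 𝒜, μ) be a measure space with μ(Ω) ≤ 1, let g : Ω → [0,∞] be measurable, and let G : Ω × [0,T] → [0,∞] be measurable. Then ( ∫_Ω [ g(ω) + ∫_0^T (κ/2) e^{κs/2} G(ω,s) ds ] dμ(ω) )² ≤ e^{κT/2} · ∫_Ω [ g(ω)² + ∫_0^T (κ/2) e^{κs/2} G(ω,s)² ds ] dμ(ω), where all integrals are Lebesgue integrals with values in [0,∞]. -/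
open MeasureTheory ENNReal

/-- Weighted Cauchy–Schwarz inequality for the Lebesgue integral. -/
lemma sq_lintegral_mul_le {α : Type*} [MeasurableSpace α] (ν : Measure α)
    {w f : α → ℝ≥0∞} (hw : AEMeasurable w ν) (hf : AEMeasurable f ν) :
    (∫⁻ a, w a * f a ∂ν) ^ 2 ≤ (∫⁻ a, w a ∂ν) * ∫⁻ a, w a * f a ^ 2 ∂ν := by
  have sqrt_sq : ∀ x : ℝ≥0∞, (x ^ (1 / 2 : ℝ)) ^ 2 = x := fun x ↦ by
    rw [← ENNReal.rpow_natCast, ← ENNReal.rpow_mul]; norm_num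
  have sqrt_mul_self : ∀ x : ℝ≥0∞, x ^ (1 / 2 : ℝ) * x ^ (1 / 2 : ℝ) = x := fun x ↦ by
    rw [← sq, sqrt_sq]
  have sq_sqrt : ∀ x : ℝ≥0∞, (x ^ 2) ^ (1 / 2 : ℝ) = x := fun x ↦ by
    rw [← ENNReal.rpow_natCast, ← ENNReal.rpow_mul]; norm_num
  have holder := ENNReal.lintegral_mul_norm_pow_le hw (hw.mul (hf.pow_const 2))
    (p := 1 / 2) (q := 1 / 2) (by norm_num) (by norm_num) (by norm_num)
  have integrand_eq : ∀ a, w a ^ (1 / 2 : ℝ) * (w a * f a ^ 2) ^ (1 / 2 : ℝ) = w a * f a :=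
    fun a ↦ by
      rw [ENNReal.mul_rpow_of_nonneg _ _ (by norm_num), ← mul_assoc, sqrt_mul_self, sq_sqrt]
  simp only [Pi.mul_apply, integrand_eq] at holder
  calc (∫⁻ a, w a * f a ∂ν) ^ 2
      ≤ ((∫⁻ a, w a ∂ν) ^ (1 / 2 : ℝ) * (∫⁻ a, w a * f a ^ 2 ∂ν) ^ (1 / 2 : ℝ)) ^ 2 := by
        gcongr
    _ = (∫⁻ a, w a ∂ν) * ∫⁻ a, w a * f a ^ 2 ∂ν := by
        rw [mul_pow, sqrt_sq, sqrt_sq]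

lemma add_sq_le_of_sq_le_mul {a b c B : ℝ≥0∞} (hc : c ≠ ⊤) (h : b ^ 2 ≤ c * B) :
    (a + b) ^ 2 ≤ (1 + c) * (a ^ 2 + B) := by
  rcases eq_or_ne a ⊤ with rfl | ha
  · simp [ENNReal.mul_top]
  rcases eq_or_ne B ⊤ with rfl | hB
  · simp [ENNReal.mul_top]
  have hb : b ≠ ⊤ := by
    rintro rfl
    simp [ENNReal.mul_eq_top, hc, hB] at h
  lift a to NNReal using ha
  lift b to NNReal using hb
  lift c to NNReal using hc
  lift B to NNReal using hB
  norm_cast at h ⊢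
  rw [← NNReal.coe_le_coe] at h ⊢
  push_cast at h ⊢
  have cross : 2 * (a : ℝ) * b ≤ B + c * a ^ 2 := by
    apply le_of_sq_le_sq _ (by positivity)
    nlinarith [sq_nonneg ((B : ℝ) - c * a ^ 2), mul_le_mul_of_nonneg_left h (sq_nonneg (a : ℝ))]
  nlinarith

lemma lintegral_Icc_exp_weight (κ T : ℝ) (hκ : 0 ≤ κ) (hT : 0 ≤ T) :
    ∫⁻ s in Set.Icc (0 : ℝ) T, ENNReal.ofReal (κ / 2 * Real.exp (κ * s / 2)) =
      ENNReal.ofReal (Real.exp (κ * T / 2) - 1) := by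
  have hcont : Continuous fun s : ℝ ↦ κ / 2 * Real.exp (κ * s / 2) := by fun_prop
  rw [← ofReal_integral_eq_lintegral_ofReal
      (hcont.continuousOn.integrableOn_compact isCompact_Icc)
      (Filter.Eventually.of_forall fun s ↦ by positivity),
    integral_Icc_eq_integral_Ioc, ← intervalIntegral.integral_of_le hT,
    intervalIntegral.integral_eq_sub_of_hasDerivAt (f := fun s ↦ Real.exp (κ * s / 2)) _
      (hcont.intervalIntegrable _ _)]
  · simp
  · intro s _
    simpa [mul_comm] using (((hasDerivAt_id s).const_mul κ).div_const 2).exp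

/-- The Cauchy–Schwarz-type upgrade from the linear to the quadratic parallel-gradient
estimate ((R2) ⇒ (R3)): for a (sub)probability measure `μ`, nonnegative measurable `g`
and `G`, `κ ≥ 0` and `T ≥ 0`,
`(∫ [g + ∫₀ᵀ (κ/2)e^{κs/2} G(·,s) ds] dμ)² ≤ e^{κT/2} ∫ [g² + ∫₀ᵀ (κ/2)e^{κs/2} G(·,s)² ds] dμ`. -/
theorem linear_to_quadratic_gradient_estimate
    {Ω : Type*} [MeasurableSpace Ω] (μ : Measure Ω) (hμ : μ Set.univ ≤ 1)
    (κ T : ℝ) (hκ : 0 ≤ κ) (hT : 0 ≤ T)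
    (g : Ω → ℝ≥0∞) (hg : Measurable g)
    (G : Ω → ℝ → ℝ≥0∞) (hG : Measurable (Function.uncurry G)) :
    (∫⁻ ω, (g ω + ∫⁻ s in Set.Icc (0 : ℝ) T,
        ENNReal.ofReal (κ / 2 * Real.exp (κ * s / 2)) * G ω s) ∂μ) ^ 2 ≤
      ENNReal.ofReal (Real.exp (κ * T / 2)) *
        ∫⁻ ω, ((g ω) ^ 2 + ∫⁻ s in Set.Icc (0 : ℝ) T,
          ENNReal.ofReal (κ / 2 * Real.exp (κ * s / 2)) * (G ω s) ^ 2) ∂μ := by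
  have hw : Measurable fun s : ℝ ↦ ENNReal.ofReal (κ / 2 * Real.exp (κ * s / 2)) := by fun_prop
  have hF : Measurable fun ω ↦ g ω + ∫⁻ s in Set.Icc (0 : ℝ) T,
      ENNReal.ofReal (κ / 2 * Real.exp (κ * s / 2)) * G ω s :=
    hg.add ((hw.comp measurable_snd).mul hG).lintegral_prod_right'
  have hE : 1 + ENNReal.ofReal (Real.exp (κ * T / 2) - 1) =
      ENNReal.ofReal (Real.exp (κ * T / 2)) := by
    rw [← ENNReal.ofReal_one, ← ENNReal.ofReal_add zero_le_one
      (sub_nonneg.2 (Real.one_le_exp (by positivity)))]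
    simp
  have hCS := sq_lintegral_mul_le μ (w := fun _ ↦ 1) aemeasurable_const hF.aemeasurable
  simp only [one_mul, lintegral_const] at hCS
  refine hCS.trans ((mul_le_of_le_one_left' hμ).trans ?_)
  rw [← lintegral_const_mul' _ _ ENNReal.ofReal_ne_top]
  refine lintegral_mono fun ω ↦ ?_
  rw [← hE]
  refine add_sq_le_of_sq_le_mul ENNReal.ofReal_ne_top ?_
  rw [← lintegral_Icc_exp_weight κ T hκ hT]
  exact sq_lintegral_mul_le _ hw.aemeasurable (hG.comp measurable_prodMk_left).aemeasurable
end

section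
/- Let κ ≥ 0, T ≥ 0, and let g : [0,T] → [0,∞] be measurable. Then ∫_0^T e^{κ(T−t)/2} g(t) dt + ∫_0^T ( ∫_t^T (κ/2) e^{κ(T+s−2t)/2} g(s) ds ) dt = e^{κT/2} ∫_0^T cosh(κt/2) g(t) dt, and moreover e^{κT/2} ∫_0^T cosh(κt/2) g(t) dt ≤ ((e^{κT} + 1)/2) · ∫_0^T g(t) dt. -/
open MeasureTheory ENNReal

/-- Tonelli's theorem on the triangle `a ≤ t ≤ s ≤ b`. -/
theorem setLIntegral_Icc_triangle_swap (a b : ℝ) {F : ℝ → ℝ → ℝ≥0∞}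
    (hF : Measurable (Function.uncurry F)) :
    ∫⁻ t in Set.Icc a b, ∫⁻ s in Set.Icc t b, F t s =
      ∫⁻ s in Set.Icc a b, ∫⁻ t in Set.Icc a s, F t s := by
  have inner_left : ∀ t ∈ Set.Icc a b, ∫⁻ s in Set.Icc t b, F t s =
      ∫⁻ s in Set.Icc a b, {p : ℝ × ℝ | p.1 ≤ p.2}.indicator (Function.uncurry F) (t, s) := by
    intro t ht
    have hset : Set.Icc t b = Set.Ici t ∩ Set.Icc a b := by
      ext s
      simp only [Set.mem_Icc, Set.mem_inter_iff, Set.mem_Ici]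
      exact ⟨fun h => ⟨h.1, ht.1.trans h.1, h.2⟩, fun h => ⟨h.1, h.2.2⟩⟩
    rw [hset, ← setLIntegral_indicator measurableSet_Ici]
    rfl
  have inner_right : ∀ s ∈ Set.Icc a b, ∫⁻ t in Set.Icc a s, F t s =
      ∫⁻ t in Set.Icc a b, {p : ℝ × ℝ | p.1 ≤ p.2}.indicator (Function.uncurry F) (t, s) := by
    intro s hs
    have hset : Set.Icc a s = Set.Iic s ∩ Set.Icc a b := by
      ext t
      simp only [Set.mem_Icc, Set.mem_inter_iff, Set.mem_Iic]
      exact ⟨fun h => ⟨h.2, h.1, h.2.trans hs.2⟩, fun h => ⟨h.2.1, h.1⟩⟩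
    rw [hset, ← setLIntegral_indicator measurableSet_Iic]
    rfl
  rw [setLIntegral_congr_fun measurableSet_Icc inner_left,
    setLIntegral_congr_fun measurableSet_Icc inner_right]
  exact lintegral_lintegral_swap
    (hF.indicator (measurableSet_le measurable_fst measurable_snd)).aemeasurable

/-- The integral of the exponential kernel in its first variable. -/
theorem setLIntegral_exp_kernel {κ : ℝ} (hκ : 0 ≤ κ) (T : ℝ) {s : ℝ} (hs : 0 ≤ s) :
    ∫⁻ t in Set.Icc (0 : ℝ) s,
        ENNReal.ofReal (κ / 2 * Real.exp (κ * (T + s - 2 * t) / 2)) =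
      ENNReal.ofReal ((Real.exp (κ * (T + s) / 2) - Real.exp (κ * (T - s) / 2)) / 2) := by
  have hcont : Continuous fun t : ℝ => κ / 2 * Real.exp (κ * (T + s - 2 * t) / 2) := by fun_prop
  rw [← ofReal_integral_eq_lintegral_ofReal
    (hcont.continuousOn.integrableOn_compact isCompact_Icc)
    (Filter.Eventually.of_forall fun t => by positivity),
    integral_Icc_eq_integral_Ioc, ← intervalIntegral.integral_of_le hs,
    intervalIntegral.integral_eq_sub_of_hasDerivAt
      (f := fun t => -(Real.exp (κ * (T + s - 2 * t) / 2) / 2)) _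
      (hcont.intervalIntegrable _ _)]
  · congr 1
    ring_nf
  · intro t _
    have hlin : HasDerivAt (fun t : ℝ => κ * (T + s - 2 * t) / 2) (-κ) t := by
      refine (((((hasDerivAt_id t).const_mul 2).const_sub (T + s)).const_mul κ).div_const
        2).congr_deriv ?_
      ring
    refine (hlin.exp.div_const 2).neg.congr_deriv ?_
    ring

theorem exp_mul_cosh_eq (x y : ℝ) :
    Real.exp x * Real.cosh y = (Real.exp (x + y) + Real.exp (x - y)) / 2 := by
  rw [Real.cosh_eq, sub_eq_add_neg, Real.exp_add, Real.exp_add]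
  ring

/-- The computational heart of (R4) ⇒ (R7): for `κ ≥ 0`, `T ≥ 0` and measurable
`g : [0,T] → [0,∞]`,
`∫₀ᵀ e^{κ(T−t)/2} g(t) dt + ∫₀ᵀ ∫ₜᵀ (κ/2) e^{κ(T+s−2t)/2} g(s) ds dt
  = e^{κT/2} ∫₀ᵀ cosh(κt/2) g(t) dt ≤ ((e^{κT}+1)/2) ∫₀ᵀ g(t) dt`. -/
theorem logsob_kernel_identity_and_bound
    (κ T : ℝ) (hκ : 0 ≤ κ) (hT : 0 ≤ T) (g : ℝ → ℝ≥0∞) (hg : Measurable g) :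
    ((∫⁻ t in Set.Icc (0 : ℝ) T, ENNReal.ofReal (Real.exp (κ * (T - t) / 2)) * g t) +
      ∫⁻ t in Set.Icc (0 : ℝ) T, ∫⁻ s in Set.Icc t T,
        ENNReal.ofReal (κ / 2 * Real.exp (κ * (T + s - 2 * t) / 2)) * g s)
      = ENNReal.ofReal (Real.exp (κ * T / 2)) *
          ∫⁻ t in Set.Icc (0 : ℝ) T, ENNReal.ofReal (Real.cosh (κ * t / 2)) * g t ∧
    ENNReal.ofReal (Real.exp (κ * T / 2)) *
        (∫⁻ t in Set.Icc (0 : ℝ) T, ENNReal.ofReal (Real.cosh (κ * t / 2)) * g t) ≤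
      ENNReal.ofReal ((Real.exp (κ * T) + 1) / 2) * ∫⁻ t in Set.Icc (0 : ℝ) T, g t := by
  refine ⟨?_, ?_⟩
  · have hker : Measurable (Function.uncurry fun t s : ℝ =>
        ENNReal.ofReal (κ / 2 * Real.exp (κ * (T + s - 2 * t) / 2)) * g s) := by
      unfold Function.uncurry
      fun_prop
    rw [setLIntegral_Icc_triangle_swap 0 T hker, ← lintegral_add_left (by fun_prop),
      ← lintegral_const_mul _ (by fun_prop)]
    refine setLIntegral_congr_fun measurableSet_Icc fun s hs => ?_
    have hle : Real.exp (κ * (T - s) / 2) ≤ Real.exp (κ * (T + s) / 2) :=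
      Real.exp_le_exp.2 (by nlinarith [mul_nonneg hκ hs.1])
    rw [lintegral_mul_const _ (by fun_prop), setLIntegral_exp_kernel hκ T hs.1, ← add_mul,
      ← ENNReal.ofReal_add (Real.exp_nonneg _) (by linarith), ← mul_assoc,
      ← ENNReal.ofReal_mul (Real.exp_nonneg _), exp_mul_cosh_eq]
    congr 2
    ring_nf
  · rw [← lintegral_const_mul _ (by fun_prop), ← lintegral_const_mul _ hg]
    refine setLIntegral_mono (by fun_prop) fun t ht => ?_
    rw [← mul_assoc, ← ENNReal.ofReal_mul (Real.exp_nonneg _)]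
    gcongr
    calc Real.exp (κ * T / 2) * Real.cosh (κ * t / 2)
        ≤ Real.exp (κ * T / 2) * Real.cosh (κ * T / 2) := by
          gcongr
          rw [Real.cosh_le_cosh, abs_of_nonneg (by have := ht.1; positivity),
            abs_of_nonneg (by positivity)]
          gcongr
          exact ht.2
      _ = (Real.exp (κ * T) + 1) / 2 := by
          rw [exp_mul_cosh_eq, add_halves, sub_self, Real.exp_zero]
end
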